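/- Let q ∈ ℂ be nonzero and not a nontrivial root of unity, and let n ≥ 0. In the (H_{n+1}(q), H_{n+1}(q))-bimodule H_{n+1}(q) ⊗_{H_n(q)} H_{n+1}(q), let σ = Σ_{i=1}^{n+1} q^{i−(n+1)} (t_i t_{i+1} ⋯ t_n) ⊗ (t_n t_{n−1} ⋯ t_i), with the convention t_{n+1} = 1 so that the i = n+1 summand is 1 ⊗ 1. Then x·σ = σ·x for all x ∈ H_{n+1}(q); equivalently, the map H_{n+1}(q) → H_{n+1}(q) ⊗_{H_n(q)} H_{n+1}(q), z ↦ z·σ, is a homomorphism of (H_{n+1}(q), H_{n+1}(q))-bimodules. (This is the left-cup adjunction map making induction and restriction biadjoint.) -/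

import Mathlib

open scoped TensorProduct

/-- The defining relations of the Hecke algebra `H_n(q)`, on generators
`t_1, …, t_{n−1}` (the generator `FreeAlgebra.ι ℂ i` for `i : Fin (n-1)` is `t_{i+1}`):
the quadratic relations `t_i² = q + (q−1)t_i`, the commutation relations
`t_i t_j = t_j t_i` for `|i−j| > 1`, and the braid relations
`t_i t_{i+1} t_i = t_{i+1} t_i t_{i+1}`. -/
inductive HeckeRel (q : ℂ) (n : ℕ) :
    FreeAlgebra ℂ (Fin (n - 1)) → FreeAlgebra ℂ (Fin (n - 1)) → Prop
  | quad (i : Fin (n - 1)) :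
      HeckeRel q n (FreeAlgebra.ι ℂ i * FreeAlgebra.ι ℂ i)
        (q • 1 + (q - 1) • FreeAlgebra.ι ℂ i)
  | comm (i j : Fin (n - 1)) (h : (i : ℕ) + 1 < (j : ℕ) ∨ (j : ℕ) + 1 < (i : ℕ)) :
      HeckeRel q n (FreeAlgebra.ι ℂ i * FreeAlgebra.ι ℂ j)
        (FreeAlgebra.ι ℂ j * FreeAlgebra.ι ℂ i)
  | braid (i j : Fin (n - 1)) (h : (j : ℕ) = (i : ℕ) + 1) :
      HeckeRel q n (FreeAlgebra.ι ℂ i * FreeAlgebra.ι ℂ j * FreeAlgebra.ι ℂ i)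
        (FreeAlgebra.ι ℂ j * FreeAlgebra.ι ℂ i * FreeAlgebra.ι ℂ j)

/-- The Hecke algebra `H_n(q)`. -/
abbrev Hecke (q : ℂ) (n : ℕ) : Type := RingQuot (HeckeRel q n)

/-- The generator `t_{i+1}` of `H_n(q)`, for `i : Fin (n-1)`. -/
noncomputable def T (q : ℂ) (n : ℕ) (i : Fin (n - 1)) : Hecke q n :=
  RingQuot.mkAlgHom ℂ (HeckeRel q n) (FreeAlgebra.ι ℂ i)

/-- The generator `t_{j+1}` of `H_n(q)` for a natural number index `j` (so `tN q n j`
is the `(j+1)`-st standard generator, defined to be `0` if `j` is out of range). -/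
noncomputable def tN (q : ℂ) (n : ℕ) (j : ℕ) : Hecke q n :=
  if h : j < n - 1 then T q n ⟨j, h⟩ else 0

/-- The ascending word `t_{a+1} t_{a+2} ⋯ t_b` in `H_n(q)` (in 1-based notation;
in terms of `tN` this is `tN a * tN (a+1) * ⋯ * tN (b-1)`, and `1` if `b ≤ a`). -/
noncomputable def ascWord (q : ℂ) (n : ℕ) (a b : ℕ) : Hecke q n :=
  ((List.range' a (b - a)).map (tN q n)).prod

/-- The descending word `t_b t_{b-1} ⋯ t_{a+1}` in `H_n(q)` (in 1-based notation;
`1` if `b ≤ a`). -/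
noncomputable def descWord (q : ℂ) (n : ℕ) (a b : ℕ) : Hecke q n :=
  (((List.range' a (b - a)).map (tN q n)).reverse).prod

/-- The Jucys–Murphy element `L_k ∈ H_n(q)`:  `L_1 = 0` and
`L_{k+1} = Σ_{i=1}^{k} q^{i−k} t_i t_{i+1} ⋯ t_{k-1} t_k t_{k-1} ⋯ t_{i+1} t_i`
(the term for `i` is `q^{i-k}` times the ascending word `t_i ⋯ t_k` times the
descending word `t_{k-1} ⋯ t_i`).  Here `JM q n 0 = 0` is a junk value. -/
noncomputable def JM (q : ℂ) (n : ℕ) : ℕ → Hecke q n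
  | 0 => 0
  | k + 1 => ∑ i ∈ Finset.range k,
      q ^ (((i : ℤ) + 1) - (k : ℤ)) • (ascWord q n i k * descWord q n i (k - 1))

/-- The lift of the element
`σ = Σ_{i=1}^{n+1} q^{i−(n+1)} (t_i t_{i+1} ⋯ t_n) ⊗ (t_n t_{n−1} ⋯ t_i)`
to `H_{n+1}(q) ⊗_ℂ H_{n+1}(q)` (the `i = n+1` summand being `1 ⊗ 1`). -/
noncomputable def sigmaLift (q : ℂ) (n : ℕ) : Hecke q (n + 1) ⊗[ℂ] Hecke q (n + 1) :=
  ∑ i ∈ Finset.range (n + 1),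
    q ^ ((i : ℤ) - (n : ℤ)) •
      (ascWord q (n + 1) i n ⊗ₜ[ℂ] descWord q (n + 1) i n)

/-- The ℂ-subspace of `H_{n+1}(q) ⊗_ℂ H_{n+1}(q)` spanned by the `H_n(q)`-balanced
differences `(x · ι(c)) ⊗ y − x ⊗ (ι(c) · y)`; the quotient by this subspace is
`H_{n+1}(q) ⊗_{H_n(q)} H_{n+1}(q)`. -/
noncomputable def balancedSub (q : ℂ) (n : ℕ)
    (ι : Hecke q n →ₐ[ℂ] Hecke q (n + 1)) :
    Submodule ℂ (Hecke q (n + 1) ⊗[ℂ] Hecke q (n + 1)) :=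
  Submodule.span ℂ
    {z | ∃ (x y : Hecke q (n + 1)) (c : Hecke q n),
      z = (x * ι c) ⊗ₜ[ℂ] y - x ⊗ₜ[ℂ] (ι c * y)}

section Generators

variable (q : ℂ) (n : ℕ)

lemma tN_mul_self {j : ℕ} (hj : j < n - 1) :
    tN q n j * tN q n j = q • 1 + (q - 1) • tN q n j := by
  have h := RingQuot.mkAlgHom_rel ℂ (HeckeRel.quad (q := q) (n := n) ⟨j, hj⟩)
  simpa only [map_mul, map_add, map_smul, map_one, tN, dif_pos hj, T] using h

lemma tN_commute {i j : ℕ} (h : i + 1 < j ∨ j + 1 < i) : Commute (tN q n i) (tN q n j) := by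
  by_cases hi : i < n - 1
  · by_cases hj : j < n - 1
    · have h := RingQuot.mkAlgHom_rel ℂ (HeckeRel.comm (q := q) (n := n) ⟨i, hi⟩ ⟨j, hj⟩ h)
      simpa only [Commute, SemiconjBy, map_mul, tN, dif_pos hi, dif_pos hj, T] using h
    · simp [tN, hj]
  · simp [tN, hi]

lemma tN_braid {k : ℕ} (hk : k + 1 < n - 1) :
    tN q n k * tN q n (k + 1) * tN q n k = tN q n (k + 1) * tN q n k * tN q n (k + 1) := by
  have hk' : k < n - 1 := by omega
  have h := RingQuot.mkAlgHom_rel ℂ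
    (HeckeRel.braid (q := q) (n := n) ⟨k, hk'⟩ ⟨k + 1, hk⟩ rfl)
  simpa only [map_mul, tN, dif_pos hk, dif_pos hk', T] using h

lemma commute_ascWord {x : Hecke q n} {a b : ℕ}
    (h : ∀ i, a ≤ i → i < b → Commute x (tN q n i)) : Commute x (ascWord q n a b) := by
  refine Commute.list_prod_right _ _ fun y hy => ?_
  obtain ⟨i, hi, rfl⟩ := List.mem_map.1 hy
  rw [List.mem_range'_1] at hi
  exact h i hi.1 (by omega)

lemma commute_descWord {x : Hecke q n} {a b : ℕ}
    (h : ∀ i, a ≤ i → i < b → Commute x (tN q n i)) : Commute x (descWord q n a b) := by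
  refine Commute.list_prod_right _ _ fun y hy => ?_
  obtain ⟨i, hi, rfl⟩ := List.mem_map.1 (List.mem_reverse.1 hy)
  rw [List.mem_range'_1] at hi
  exact h i hi.1 (by omega)

lemma range'_sub_append {a b c : ℕ} (hab : a ≤ b) (hbc : b ≤ c) :
    List.range' a (c - a) = List.range' a (b - a) ++ List.range' b (c - b) := by
  have h := List.range'_append_1 (s := a) (m := b - a) (n := c - b)
  rw [show a + (b - a) = b by omega, show b - a + (c - b) = c - a by omega] at h
  exact h.symm

lemma ascWord_mul_ascWord {a b c : ℕ} (hab : a ≤ b) (hbc : b ≤ c) :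
    ascWord q n a b * ascWord q n b c = ascWord q n a c := by
  simp [ascWord, range'_sub_append hab hbc]

lemma descWord_mul_descWord {a b c : ℕ} (hab : a ≤ b) (hbc : b ≤ c) :
    descWord q n b c * descWord q n a b = descWord q n a c := by
  simp [descWord, range'_sub_append hab hbc]

lemma ascWord_eq_tN_mul {a c : ℕ} (h : a < c) :
    ascWord q n a c = tN q n a * ascWord q n (a + 1) c := by
  rw [← ascWord_mul_ascWord q n (Nat.le_succ a) h]
  simp [ascWord]

lemma descWord_eq_mul_tN {a c : ℕ} (h : a < c) :
    descWord q n a c = descWord q n (a + 1) c * tN q n a := by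
  rw [← descWord_mul_descWord q n (Nat.le_succ a) h]
  simp [descWord]

/-- Moving a generator through an ascending word lowers its index by one. -/
lemma tN_succ_mul_ascWord {i k b : ℕ} (hik : i ≤ k) (hkb : k + 1 < b) (hk : k + 1 < n - 1) :
    tN q n (k + 1) * ascWord q n i b = ascWord q n i b * tN q n k := by
  have h₁ : Commute (tN q n (k + 1)) (ascWord q n i k) :=
    commute_ascWord q n fun l _ hl => tN_commute q n (by omega)
  have h₂ : Commute (tN q n k) (ascWord q n (k + 1 + 1) b) :=
    commute_ascWord q n fun l hl _ => tN_commute q n (by omega)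
  rw [← ascWord_mul_ascWord q n hik (by omega : k ≤ b), ascWord_eq_tN_mul q n (by omega : k < b),
    ascWord_eq_tN_mul q n hkb, ← mul_assoc, h₁.eq]
  simp only [mul_assoc, ← h₂.eq]
  congr 1
  simpa only [mul_assoc] using
    congrArg (· * ascWord q n (k + 1 + 1) b) (tN_braid q n hk).symm

/-- Moving a generator through a descending word raises its index by one. -/
lemma tN_mul_descWord {i k b : ℕ} (hik : i ≤ k) (hkb : k + 1 < b) (hk : k + 1 < n - 1) :
    tN q n k * descWord q n i b = descWord q n i b * tN q n (k + 1) := by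
  have h₁ : Commute (tN q n (k + 1)) (descWord q n i k) :=
    commute_descWord q n fun l _ hl => tN_commute q n (by omega)
  have h₂ : Commute (tN q n k) (descWord q n (k + 1 + 1) b) :=
    commute_descWord q n fun l hl _ => tN_commute q n (by omega)
  rw [← descWord_mul_descWord q n hik (by omega : k ≤ b),
    descWord_eq_mul_tN q n (by omega : k < b), descWord_eq_mul_tN q n hkb]
  simp only [mul_assoc, ← h₁.eq]
  rw [← mul_assoc, h₂.eq, mul_assoc]
  congr 1
  simpa only [mul_assoc] using congrArg (· * descWord q n i k) (tN_braid q n hk)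

/-- Induction principle: a predicate closed under sums and products that holds for scalars and
generators holds on the whole Hecke algebra. -/
lemma Hecke.induction {P : Hecke q n → Prop} (algebraMap : ∀ c : ℂ, P (algebraMap ℂ _ c))
    (gen : ∀ j < n - 1, P (tN q n j)) (mul : ∀ x y, P x → P y → P (x * y))
    (add : ∀ x y, P x → P y → P (x + y)) (x : Hecke q n) : P x := by
  obtain ⟨x, rfl⟩ := RingQuot.mkAlgHom_surjective ℂ (HeckeRel q n) x
  induction x using FreeAlgebra.induction with
  | grade0 c => simpa using algebraMap c
  | grade1 j => simpa [tN, T] using gen j j.2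
  | mul x y hx hy => simpa using mul _ _ hx hy
  | add x y hx hy => simpa using add _ _ hx hy

end Generators

section Balanced

variable {q : ℂ} {n : ℕ} (ι : Hecke q n →ₐ[ℂ] Hecke q (n + 1))

lemma map_mulLeft_mem_balancedSub (a : Hecke q (n + 1))
    {z : Hecke q (n + 1) ⊗[ℂ] Hecke q (n + 1)} (hz : z ∈ balancedSub q n ι) :
    TensorProduct.map (LinearMap.mulLeft ℂ a) LinearMap.id z ∈ balancedSub q n ι := by
  refine (Submodule.span_le (p := (balancedSub q n ι).comap
    (TensorProduct.map (LinearMap.mulLeft ℂ a) LinearMap.id))).2 ?_ hz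
  rintro _ ⟨x, y, c, rfl⟩
  exact Submodule.subset_span ⟨a * x, y, c, by simp [mul_assoc]⟩

lemma map_mulRight_mem_balancedSub (a : Hecke q (n + 1))
    {z : Hecke q (n + 1) ⊗[ℂ] Hecke q (n + 1)} (hz : z ∈ balancedSub q n ι) :
    TensorProduct.map LinearMap.id (LinearMap.mulRight ℂ a) z ∈ balancedSub q n ι := by
  refine (Submodule.span_le (p := (balancedSub q n ι).comap
    (TensorProduct.map LinearMap.id (LinearMap.mulRight ℂ a)))).2 ?_ hz
  rintro _ ⟨x, y, c, rfl⟩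
  exact Submodule.subset_span ⟨x, y * a, c, by simp [mul_assoc]⟩

/-- An element of the tensor square commuting with all generators modulo the balanced
differences commutes with the whole Hecke algebra. -/
lemma commutator_mem_balancedSub_of_generators (s : Hecke q (n + 1) ⊗[ℂ] Hecke q (n + 1))
    (hs : ∀ j < n, TensorProduct.map (LinearMap.mulLeft ℂ (tN q (n + 1) j)) LinearMap.id s
      - TensorProduct.map LinearMap.id (LinearMap.mulRight ℂ (tN q (n + 1) j)) s
      ∈ balancedSub q n ι) (x : Hecke q (n + 1)) :
    TensorProduct.map (LinearMap.mulLeft ℂ x) LinearMap.id s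
      - TensorProduct.map LinearMap.id (LinearMap.mulRight ℂ x) s ∈ balancedSub q n ι := by
  induction x using Hecke.induction with
  | algebraMap c =>
    have hl : LinearMap.mulLeft ℂ (algebraMap ℂ (Hecke q (n + 1)) c) = c • LinearMap.id := by
      ext y; simp [Algebra.smul_def]
    have hr : LinearMap.mulRight ℂ (algebraMap ℂ (Hecke q (n + 1)) c) = c • LinearMap.id := by
      ext y; simp [Algebra.smul_def, Algebra.commutes]
    rw [hl, hr, TensorProduct.map_smul_left, TensorProduct.map_smul_right, sub_self]
    exact zero_mem _
  | gen j hj => exact hs j hj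
  | mul x y hx hy =>
    have h := add_mem (map_mulLeft_mem_balancedSub ι x hy) (map_mulRight_mem_balancedSub ι y hx)
    have hc : TensorProduct.map (LinearMap.mulLeft ℂ x) LinearMap.id
          (TensorProduct.map LinearMap.id (LinearMap.mulRight ℂ y) s)
        = TensorProduct.map LinearMap.id (LinearMap.mulRight ℂ y)
          (TensorProduct.map (LinearMap.mulLeft ℂ x) LinearMap.id s) := by
      simp only [← LinearMap.comp_apply, ← TensorProduct.map_comp, LinearMap.id_comp,
        LinearMap.comp_id]
    rw [map_sub, map_sub, hc, sub_add_sub_cancel] at h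
    simpa only [← LinearMap.comp_apply, ← TensorProduct.map_comp, LinearMap.id_comp,
      ← LinearMap.mulLeft_mul, ← LinearMap.mulRight_mul] using h
  | add x y hx hy =>
    have hl : LinearMap.mulLeft ℂ (x + y) = LinearMap.mulLeft ℂ x + LinearMap.mulLeft ℂ y := by
      ext z; simp [add_mul]
    have hr : LinearMap.mulRight ℂ (x + y) = LinearMap.mulRight ℂ x + LinearMap.mulRight ℂ y := by
      ext z; simp [mul_add]
    rw [hl, hr, TensorProduct.map_add_left, TensorProduct.map_add_right, LinearMap.add_apply,
      LinearMap.add_apply]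
    convert add_mem hx hy using 1
    abel

lemma tmul_sub_tmul_mem_balancedSub
    (hι : ∀ i : Fin (n - 1), ι (T q n i) = tN q (n + 1) (i : ℕ))
    {k : ℕ} (hk : k < n - 1) (x y : Hecke q (n + 1)) :
    (x * tN q (n + 1) k) ⊗ₜ[ℂ] y - x ⊗ₜ[ℂ] (tN q (n + 1) k * y) ∈ balancedSub q n ι :=
  Submodule.subset_span ⟨x, y, T q n ⟨k, hk⟩, by rw [hι]⟩

/-- A generator commutes with every summand of `σ` other than the two adjacent to it. -/
lemma word_commutator_mem_balancedSub
    (hι : ∀ i : Fin (n - 1), ι (T q n i) = tN q (n + 1) (i : ℕ))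
    {i j : ℕ} (hi : i ≤ n) (hj : j < n) (hij : i < j ∨ j + 1 < i) :
    (tN q (n + 1) j * ascWord q (n + 1) i n) ⊗ₜ[ℂ] descWord q (n + 1) i n
      - ascWord q (n + 1) i n ⊗ₜ[ℂ] (descWord q (n + 1) i n * tN q (n + 1) j)
      ∈ balancedSub q n ι := by
  rcases hij with h | h
  · obtain ⟨k, rfl⟩ : ∃ k, j = k + 1 := ⟨j - 1, by omega⟩
    rw [tN_succ_mul_ascWord q (n + 1) (by omega) hj (by omega),
      ← tN_mul_descWord q (n + 1) (by omega) hj (by omega)]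
    exact tmul_sub_tmul_mem_balancedSub ι hι (by omega) _ _
  · rw [(commute_ascWord q (n + 1) fun l hl _ => tN_commute q (n + 1) (by omega) :
        Commute (tN q (n + 1) j) (ascWord q (n + 1) i n)).eq,
      ← (commute_descWord q (n + 1) fun l hl _ => tN_commute q (n + 1) (by omega) :
        Commute (tN q (n + 1) j) (descWord q (n + 1) i n)).eq]
    exact tmul_sub_tmul_mem_balancedSub ι hι (by omega) _ _

end Balanced

/-- The two summands of `σ` adjacent to a generator have cancelling commutators with it. -/
lemma adjacent_word_commutators_cancel (q : ℂ) {n j : ℕ} (hj : j < n) :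
    ((tN q (n + 1) j * ascWord q (n + 1) j n) ⊗ₜ[ℂ] descWord q (n + 1) j n
      - ascWord q (n + 1) j n ⊗ₜ[ℂ] (descWord q (n + 1) j n * tN q (n + 1) j))
    + q • ((tN q (n + 1) j * ascWord q (n + 1) (j + 1) n) ⊗ₜ[ℂ] descWord q (n + 1) (j + 1) n
      - ascWord q (n + 1) (j + 1) n ⊗ₜ[ℂ] (descWord q (n + 1) (j + 1) n * tN q (n + 1) j))
    = 0 := by
  rw [ascWord_eq_tN_mul q (n + 1) hj, descWord_eq_mul_tN q (n + 1) hj, ← mul_assoc,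
    mul_assoc (descWord _ _ _ _), tN_mul_self q (n + 1) (by omega)]
  simp only [add_mul, mul_add, smul_mul_assoc, mul_smul_comm, one_mul, mul_one,
    TensorProduct.add_tmul, TensorProduct.tmul_add, ← TensorProduct.smul_tmul',
    TensorProduct.tmul_smul]
  have h {V : Type} [AddCommGroup V] [Module ℂ V] (a b c : V) :
      q • a + (q - 1) • b - (q • c + (q - 1) • b) + q • (c - a) = 0 := by module
  exact h (V := Hecke q (n + 1) ⊗[ℂ] Hecke q (n + 1)) _ _ _

/-- for `q` nonzero and not a nontrivial root of unity, the element
`σ = Σ_{i=1}^{n+1} q^{i−(n+1)} (t_i ⋯ t_n) ⊗ (t_n ⋯ t_i)` of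
`H_{n+1}(q) ⊗_{H_n(q)} H_{n+1}(q)` is central for the bimodule structure:
`x·σ = σ·x` for all `x ∈ H_{n+1}(q)`.  In the ℂ-tensor square this says that
`x·σ' − σ'·x` lies in the span of the `H_n(q)`-balanced differences, where `σ'`
is the evident lift of `σ`.  Equivalently, `z ↦ z·σ` is a homomorphism of
`(H_{n+1}(q), H_{n+1}(q))`-bimodules `H_{n+1}(q) → H_{n+1}(q) ⊗_{H_n(q)} H_{n+1}(q)`. -/
theorem hecke_left_cup_bimodule_map (q : ℂ) (hq0 : q ≠ 0)
    (hq1 : ∀ k : ℕ, 0 < k → q ^ k = 1 → q = 1) (n : ℕ)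
    (ι : Hecke q n →ₐ[ℂ] Hecke q (n + 1))
    (hι : ∀ i : Fin (n - 1), ι (T q n i) = tN q (n + 1) (i : ℕ)) :
    ∀ x : Hecke q (n + 1),
      TensorProduct.map (LinearMap.mulLeft ℂ x) LinearMap.id (sigmaLift q n)
        - TensorProduct.map LinearMap.id (LinearMap.mulRight ℂ x) (sigmaLift q n)
        ∈ balancedSub q n ι := by
  refine commutator_mem_balancedSub_of_generators ι _ fun j hj => ?_
  simp only [sigmaLift, map_sum, map_smul, TensorProduct.map_tmul, LinearMap.mulLeft_apply,
    LinearMap.mulRight_apply, LinearMap.id_apply]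
  have hsum {V : Type} [AddCommGroup V] [Module ℂ V] (c : ℕ → ℂ) (f g : ℕ → V) :
      ∑ i ∈ Finset.range (n + 1), c i • f i - ∑ i ∈ Finset.range (n + 1), c i • g i
        = ∑ i ∈ Finset.range (n + 1), c i • (f i - g i) := by
    simp only [smul_sub, Finset.sum_sub_distrib]
  refine (congrArg (· ∈ balancedSub q n ι) (hsum _ _ _)).mpr ?_
  have hmem : j ∈ Finset.range (n + 1) := Finset.mem_range.2 (by omega)
  have hmem' : j + 1 ∈ (Finset.range (n + 1)).erase j :=
    Finset.mem_erase.2 ⟨by omega, Finset.mem_range.2 (by omega)⟩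
  rw [← Finset.add_sum_erase _ _ hmem, ← Finset.add_sum_erase _ _ hmem', ← add_assoc]
  refine add_mem ?_ (sum_mem fun i hi => Submodule.smul_mem _ _ ?_)
  · have hpow : q ^ (((j + 1 : ℕ) : ℤ) - (n : ℤ)) = q ^ ((j : ℤ) - (n : ℤ)) * q := by
      rw [← zpow_add_one₀ hq0]
      congr 1
      push_cast
      ring
    rw [hpow, mul_smul, ← smul_add, adjacent_word_commutators_cancel q hj, smul_zero]
    exact zero_mem _
  · simp only [Finset.mem_erase, Finset.mem_range] at hi
    exact word_commutator_mem_balancedSub ι hι (by omega) hj (by omega)
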